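/- arXiv:1305.6844 — 8 statements merged into one kernel-verified Lean document; each statement's English description precedes it below -/
import Mathlib

section
/- A Boolean C-algebra B is equationally Noetherian if and only if the subalgebra C generated by the constants of the language L is finite. -/
/-- Terms of the language of Boolean algebras extended by constants `cᵢ, i ∈ I`,
in the variables `x₁, …, xₙ`. -/
inductive BTerm (I : Type) (n : ℕ) : Type where
  | var : Fin n → BTerm I n
  | const : I → BTerm I n
  | bot : BTerm I n
  | top : BTerm I n
  | sup : BTerm I n → BTerm I n → BTerm I n
  | inf : BTerm I n → BTerm I n → BTerm I n
  | compl : BTerm I n → BTerm I n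

/-- Evaluation of a term in a Boolean algebra `B`, where the constant symbols are
interpreted via `c : I → B` and the variables via `b : Fin n → B`. -/
def BTerm.eval {I B : Type} [BooleanAlgebra B] (c : I → B) {n : ℕ} :
    BTerm I n → (Fin n → B) → B
  | .var i, b => b i
  | .const j, _ => c j
  | .bot, _ => ⊥
  | .top, _ => ⊤
  | .sup t s, b => t.eval c b ⊔ s.eval c b
  | .inf t s, b => t.eval c b ⊓ s.eval c b
  | .compl t, b => (t.eval c b)ᶜ

/-- An equation `t(X) = s(X)` is a pair of terms. -/
abbrev BEqn (I : Type) (n : ℕ) := BTerm I n × BTerm I n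

/-- The solution set `V_B(S)` of a system of equations `S`. -/
def solSet {I B : Type} [BooleanAlgebra B] (c : I → B) {n : ℕ}
    (S : Set (BEqn I n)) : Set (Fin n → B) :=
  {b | ∀ e ∈ S, e.1.eval c b = e.2.eval c b}

/-- The subalgebra `C ⊆ B` generated by the interpretations of the constants:
the set of values of all closed terms. -/
def constSubalg {I B : Type} [BooleanAlgebra B] (c : I → B) : Set B :=
  Set.range fun t : BTerm I 0 => t.eval c (fun i => i.elim0)

/-- `B` is equationally Noetherian: every system (in finitely many variables) is
equivalent over `B` to a finite subsystem of itself. -/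
def EqNoetherian {I B : Type} [BooleanAlgebra B] (c : I → B) : Prop :=
  ∀ (n : ℕ) (S : Set (BEqn I n)),
    ∃ Sp ⊆ S, Sp.Finite ∧ solSet c Sp = solSet c S

theorem BTerm.eval_congr_inf {I B : Type} [BooleanAlgebra B] (c : I → B) {n : ℕ}
    (t : BTerm I n) (a : B) (b b' : Fin n → B) (h : ∀ i, b i ⊓ a = b' i ⊓ a) :
    t.eval c b ⊓ a = t.eval c b' ⊓ a := by
  induction t with
  | var i => exact h i
  | const j => rfl
  | bot => rfl
  | top => rfl
  | sup t s iht ihs => simp only [BTerm.eval, inf_sup_right, iht, ihs]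
  | inf t s iht ihs =>
    simp only [BTerm.eval]
    rw [inf_inf_distrib_right, iht, ihs, ← inf_inf_distrib_right]
  | compl t iht =>
    simp only [BTerm.eval]
    have key : ∀ x : B, xᶜ ⊓ a = (x ⊓ a)ᶜ ⊓ a := by
      intro x
      rw [compl_inf, inf_sup_right, compl_inf_self, sup_bot_eq]
    rw [key, iht, ← key]

theorem eq_of_inf_compl {B : Type} [BooleanAlgebra B] (x y a : B)
    (h1 : x ⊓ a = y ⊓ a) (h2 : x ⊓ aᶜ = y ⊓ aᶜ) : x = y := by
  rw [← sup_inf_inf_compl (x := x) (y := a), h1, h2, sup_inf_inf_compl]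

theorem BTerm.eval_ext {I B : Type} [BooleanAlgebra B] (c : I → B) {n : ℕ}
    (t s : BTerm I n)
    (h : ∀ b : Fin n → B, (∀ i, b i = ⊥ ∨ b i = ⊤) → t.eval c b = s.eval c b)
    (F : Finset (Fin n)) :
    ∀ b : Fin n → B, (∀ i, i ∉ F → b i = ⊥ ∨ b i = ⊤) → t.eval c b = s.eval c b := by
  classical
  induction F using Finset.induction_on with
  | empty => intro b hb; exact h b (fun i => hb i (by simp))
  | insert j F hj ih =>
    intro b hb
    have hT : ∀ v : B, (v = ⊥ ∨ v = ⊤) →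
        t.eval c (Function.update b j v) = s.eval c (Function.update b j v) := by
      intro v hv
      apply ih
      intro i hi
      by_cases hij : i = j
      · subst hij; simpa using hv
      · rw [Function.update_of_ne hij]
        exact hb i (by simp [hij, hi])
    apply eq_of_inf_compl _ _ (b j)
    · have hc : ∀ i, b i ⊓ b j = Function.update b j ⊤ i ⊓ b j := by
        intro i
        by_cases hij : i = j
        · subst hij; simp
        · rw [Function.update_of_ne hij]
      rw [BTerm.eval_congr_inf c t _ _ _ hc, BTerm.eval_congr_inf c s _ _ _ hc,
        hT _ (Or.inr rfl)]
    · have hc : ∀ i, b i ⊓ (b j)ᶜ = Function.update b j ⊥ i ⊓ (b j)ᶜ := by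
        intro i
        by_cases hij : i = j
        · subst hij; simp
        · rw [Function.update_of_ne hij]
      rw [BTerm.eval_congr_inf c t _ _ _ hc, BTerm.eval_congr_inf c s _ _ _ hc,
        hT _ (Or.inl rfl)]

theorem BTerm.eval_mem {I B : Type} [BooleanAlgebra B] (c : I → B) {n : ℕ}
    (t : BTerm I n) (b : Fin n → B) (hb : ∀ i, b i = ⊥ ∨ b i = ⊤) :
    t.eval c b ∈ constSubalg c := by
  induction t with
  | var i =>
    rcases hb i with h | h
    · exact ⟨.bot, h.symm⟩
    · exact ⟨.top, h.symm⟩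
  | const j => exact ⟨.const j, rfl⟩
  | bot => exact ⟨.bot, rfl⟩
  | top => exact ⟨.top, rfl⟩
  | sup t s iht ihs =>
    obtain ⟨t', ht⟩ := iht
    obtain ⟨s', hs⟩ := ihs
    exact ⟨.sup t' s', by simp only [BTerm.eval] at *; rw [ht, hs]⟩
  | inf t s iht ihs =>
    obtain ⟨t', ht⟩ := iht
    obtain ⟨s', hs⟩ := ihs
    exact ⟨.inf t' s', by simp only [BTerm.eval] at *; rw [ht, hs]⟩
  | compl t iht =>
    obtain ⟨t', ht⟩ := iht
    exact ⟨.compl t', by simp only [BTerm.eval] at *; rw [ht]⟩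

theorem BTerm.exists_lift {I B : Type} [BooleanAlgebra B] (c : I → B) {n : ℕ}
    (t : BTerm I 0) :
    ∃ t' : BTerm I n, ∀ b, t'.eval c b = t.eval c (fun i => i.elim0) := by
  induction t with
  | var i => exact i.elim0
  | const j => exact ⟨.const j, fun _ => rfl⟩
  | bot => exact ⟨.bot, fun _ => rfl⟩
  | top => exact ⟨.top, fun _ => rfl⟩
  | sup t s iht ihs =>
    obtain ⟨t', ht⟩ := iht
    obtain ⟨s', hs⟩ := ihs
    exact ⟨.sup t' s', fun b => by simp only [BTerm.eval, ht, hs]⟩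
  | inf t s iht ihs =>
    obtain ⟨t', ht⟩ := iht
    obtain ⟨s', hs⟩ := ihs
    exact ⟨.inf t' s', fun b => by simp only [BTerm.eval, ht, hs]⟩
  | compl t iht =>
    obtain ⟨t', ht⟩ := iht
    exact ⟨.compl t', fun b => by simp only [BTerm.eval, ht]⟩

theorem finite_term_functions {I B : Type} [BooleanAlgebra B] (c : I → B)
    (hC : (constSubalg c).Finite) (n : ℕ) :
    (Set.range fun t : BTerm I n => (t.eval c : (Fin n → B) → B)).Finite := by
  classical
  have : Finite (constSubalg c) := hC
  let pt : (Fin n → Bool) → Fin n → B := fun ε i => if ε i then ⊤ else ⊥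
  have hpt : ∀ ε i, pt ε i = ⊥ ∨ pt ε i = ⊤ := by
    intro ε i
    by_cases h : ε i <;> simp [pt, h]
  let g : BTerm I n → ((Fin n → Bool) → constSubalg c) :=
    fun t ε => ⟨t.eval c (pt ε), t.eval_mem c _ (hpt ε)⟩
  have hg : ∀ t s, g t = g s → t.eval c = s.eval c := by
    intro t s h
    funext b
    refine BTerm.eval_ext c t s ?_ Finset.univ b (by simp)
    intro b hb
    have hbe : b = pt (fun i => decide (b i = ⊤)) := by
      funext i
      by_cases h : b i = ⊤
      · simp [pt, h]
      · have := (hb i).resolve_right h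
        simp only [pt, h]
        simp [this]
    have := congrArg Subtype.val (congrFun h (fun i => decide (b i = ⊤)))
    rw [hbe]
    exact this
  refine Set.Finite.of_finite_image (f := fun F : (Fin n → B) → B => fun ε => F (pt ε)) ?_ ?_
  · refine (Set.finite_range
      (fun (f : (Fin n → Bool) → constSubalg c) (ε : Fin n → Bool) => (f ε : B))).subset ?_
    rintro _ ⟨_, ⟨t, rfl⟩, rfl⟩
    exact ⟨g t, rfl⟩
  · rintro _ ⟨t, rfl⟩ _ ⟨s, rfl⟩ h
    apply hg
    funext ε
    exact Subtype.ext (congrFun h ε)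

theorem eqNoetherian_of_finite {I B : Type} [BooleanAlgebra B] (c : I → B)
    (hC : (constSubalg c).Finite) : EqNoetherian c := by
  intro n S
  let φ : BEqn I n → ((Fin n → B) → B) × ((Fin n → B) → B) :=
    fun e => (e.1.eval c, e.2.eval c)
  have hfin : (φ '' S).Finite := by
    refine ((finite_term_functions c hC n).prod (finite_term_functions c hC n)).subset ?_
    rintro _ ⟨e, -, rfl⟩
    exact ⟨⟨e.1, rfl⟩, ⟨e.2, rfl⟩⟩
  obtain ⟨Sp, hsub, hbij⟩ := Set.SurjOn.exists_bijOn_subset (Set.surjOn_image φ S)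
  refine ⟨Sp, hsub, ?_, ?_⟩
  · exact (hbij.finite_iff_finite).2 hfin
  · apply Set.Subset.antisymm
    · intro b hb e he
      obtain ⟨e', he', h⟩ := hbij.surjOn ⟨e, he, rfl⟩
      have h1 := congrFun (congrArg Prod.fst h) b
      have h2 := congrFun (congrArg Prod.snd h) b
      simp only [φ] at h1 h2
      rw [← h1, ← h2]
      exact hb e' he'
    · intro b hb e he
      exact hb e (hsub he)

theorem finite_of_wf {B : Type} [BooleanAlgebra B] (C : Set B)
    (hsup : ∀ x ∈ C, ∀ y ∈ C, x ⊔ y ∈ C) (hbot : ⊥ ∈ C) (hcompl : ∀ x ∈ C, xᶜ ∈ C)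
    (hwf : WellFoundedGT C) : C.Finite := by
  by_contra hinf
  have hne : ({a : C | {x | x ∈ C ∧ (a : B) ≤ x}.Infinite}).Nonempty :=
    ⟨⟨⊥, hbot⟩, fun h => hinf (h.subset fun x hx => ⟨hx, bot_le⟩)⟩
  obtain ⟨⟨a, ha⟩, hA, hmax⟩ := hwf.wf.has_min _ hne
  have hfin : ∀ b ∈ C, a < b → {x | x ∈ C ∧ b ≤ x}.Finite := by
    intro b hb hab
    by_contra h
    exact hmax ⟨b, hb⟩ h hab
  apply hA
  by_cases hex : ∃ b ∈ C, a < b ∧ b ≠ ⊤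
  · obtain ⟨b, hb, hab, hbt⟩ := hex
    have hb' : a ⊔ bᶜ ∈ C := hsup _ ha _ (hcompl _ hb)
    have hab' : a < a ⊔ bᶜ := by
      refine lt_of_le_of_ne le_sup_left fun h => hbt ?_
      have h1 : bᶜ ≤ a := by rw [h]; exact le_sup_right
      exact compl_le_self.1 (h1.trans hab.le)
    refine Set.Finite.subset
      (Set.Finite.image2 (fun x y : B => x ⊓ y) (hfin b hb hab) (hfin _ hb' hab')) ?_
    rintro x ⟨hx, hax⟩
    refine ⟨x ⊔ b, ⟨hsup _ hx _ hb, le_sup_right⟩, x ⊔ (a ⊔ bᶜ),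
      ⟨hsup _ hx _ hb', le_sup_right⟩, ?_⟩
    simp only
    rw [← sup_inf_left, inf_sup_left, inf_compl_self, sup_bot_eq, sup_eq_left]
    exact inf_le_right.trans hax
  · push Not at hex
    refine (Set.toFinite {a, ⊤}).subset ?_
    rintro x ⟨hx, hax⟩
    rcases hax.eq_or_lt with h | h
    · exact Or.inl h.symm
    · exact Or.inr (hex x hx h)

theorem finite_of_eqNoetherian {I B : Type} [BooleanAlgebra B] (c : I → B)
    (hN : EqNoetherian c) : (constSubalg c).Finite := by
  apply finite_of_wf
  · rintro _ ⟨t, rfl⟩ _ ⟨s, rfl⟩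
    exact ⟨.sup t s, rfl⟩
  · exact ⟨.bot, rfl⟩
  · rintro _ ⟨t, rfl⟩
    exact ⟨.compl t, rfl⟩
  · rw [wellFoundedGT_iff_monotone_chain_condition]
    intro f
    have hT : ∀ k, ∃ t : BTerm I 1, ∀ b, t.eval c b = f k := by
      intro k
      obtain ⟨t, ht⟩ := (f k).2
      obtain ⟨t', ht'⟩ := BTerm.exists_lift (n := 1) c t
      exact ⟨t', fun b => (ht' b).trans ht⟩
    choose T hT using hT
    let e : ℕ → BEqn I 1 := fun k => (.sup (T k) (.var 0), .var 0)
    have he : ∀ k b, (e k).1.eval c b = (e k).2.eval c b ↔ (f k : B) ≤ b 0 := by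
      intro k b
      simp only [e, BTerm.eval, hT, sup_eq_right]
    obtain ⟨Sp, hsub, hfin, heq⟩ := hN 1 (Set.range e)
    have hN : ∃ N, ∀ x ∈ Sp, ∃ k ≤ N, e k = x := by
      have hsub' : ∀ x, x ∈ Sp → ∃ k, e k = x := fun x hx => hsub hx
      choose! κ hκ using hsub'
      obtain ⟨N, hN⟩ := (hfin.image κ).bddAbove
      exact ⟨N, fun x hx => ⟨κ x, hN ⟨x, hx, rfl⟩, hκ x hx⟩⟩
    obtain ⟨N, hN⟩ := hN
    have hmem : (fun _ => (f N : B)) ∈ solSet c Sp := by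
      intro x hx
      obtain ⟨k, hk, rfl⟩ := hN x hx
      rw [he]
      exact f.monotone hk
    rw [heq] at hmem
    refine ⟨N, fun m hm => le_antisymm (f.monotone hm) ?_⟩
    exact (he m _).1 (hmem (e m) ⟨m, rfl⟩)

/-- Theorem 3: a Boolean C-algebra `B` is equationally Noetherian iff the
subalgebra `C` generated by the constants of the language is finite. -/
theorem eqNoetherian_iff_constSubalg_finite {I B : Type} [BooleanAlgebra B]
    (c : I → B) :
    EqNoetherian c ↔ (constSubalg c).Finite := by
  exact ⟨finite_of_eqNoetherian c, eqNoetherian_of_finite c⟩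
end

section
/- If a Boolean C-algebra B is consistently Noetherian, then B is equationally Noetherian. -/
/-- `B` is consistently Noetherian: every consistent system is equivalent over `B`
to a finite subsystem of itself. -/
def ConsistentlyNoetherian {I B : Type} [BooleanAlgebra B] (c : I → B) : Prop :=
  ∀ (n : ℕ) (S : Set (BEqn I n)), (solSet c S).Nonempty →
    ∃ Sp ⊆ S, Sp.Finite ∧ solSet c Sp = solSet c S

/-- Shift the variables of a term by one, freeing the variable `0`. -/
def BTerm.shift {I : Type} {n : ℕ} : BTerm I n → BTerm I (n + 1)
  | .var i => .var i.succ
  | .const j => .const j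
  | .bot => .bot
  | .top => .top
  | .sup t s => .sup t.shift s.shift
  | .inf t s => .inf t.shift s.shift
  | .compl t => .compl t.shift

theorem BTerm.eval_shift {I B : Type} [BooleanAlgebra B] (c : I → B) {n : ℕ}
    (t : BTerm I n) (b : Fin (n + 1) → B) :
    t.shift.eval c b = t.eval c (fun i => b i.succ) := by
  induction t <;> simp_all [BTerm.shift, BTerm.eval]

/-- Homogenize `t = s` to `y ⊓ t = y ⊓ s`, with `y` a new variable. -/
def homogenize {I : Type} {n : ℕ} (e : BEqn I n) : BEqn I (n + 1) :=
  (.inf (.var 0) e.1.shift, .inf (.var 0) e.2.shift)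

/-- Theorem 4: if a Boolean C-algebra is consistently Noetherian then it is
equationally Noetherian. -/
theorem eqNoetherian_of_consistentlyNoetherian {I B : Type} [BooleanAlgebra B]
    (c : I → B) (h : ConsistentlyNoetherian c) :
    EqNoetherian c := by
  intro n S
  have hne : (solSet c (homogenize '' S)).Nonempty := by
    refine ⟨fun _ => ⊥, ?_⟩
    rintro _ ⟨e, -, rfl⟩
    simp [homogenize, BTerm.eval]
  obtain ⟨Sp, hsub, hfin, heq⟩ := h (n + 1) _ hne
  obtain ⟨T, hTS, hT, rfl⟩ := Set.exists_subset_image_finite_and.1 ⟨Sp, hsub, hfin, rfl⟩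
  refine ⟨T, hTS, hT, Set.Subset.antisymm ?_ (fun b hb e he => hb e (hTS he))⟩
  intro b hb
  have h1 : (Fin.cons ⊤ b : Fin (n + 1) → B) ∈ solSet c (homogenize '' T) := by
    rintro _ ⟨e, he, rfl⟩
    simpa [homogenize, BTerm.eval, BTerm.eval_shift] using hb e he
  rw [heq] at h1
  intro e he
  simpa [homogenize, BTerm.eval, BTerm.eval_shift] using h1 _ ⟨e, he, rfl⟩
end

section
/- A Boolean C-algebra B is weakly equationally Noetherian if and only if the subalgebra C of constants is complete in B, i.e. every set of elements {c_j | j ∈ J} ⊆ C has an infimum in B and this infimum belongs to C. -/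
/-- `B` is weakly equationally Noetherian: every system is equivalent over `B` to
some finite system (not necessarily a subsystem). -/
def WeaklyEqNoetherian {I B : Type} [BooleanAlgebra B] (c : I → B) : Prop :=
  ∀ (n : ℕ) (S : Set (BEqn I n)),
    ∃ S' : Set (BEqn I n), S'.Finite ∧ solSet c S' = solSet c S

theorem BTerm.eval_inf_congr {I B : Type} [BooleanAlgebra B] (c : I → B) {n : ℕ}
    (m : B) (b b' : Fin n → B) (h : ∀ i, b i ⊓ m = b' i ⊓ m) (t : BTerm I n) :
    t.eval c b ⊓ m = t.eval c b' ⊓ m := by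
  induction t with
  | var i => exact h i
  | const j => rfl
  | bot => rfl
  | top => rfl
  | sup t s iht ihs => simp only [BTerm.eval, inf_sup_right, iht, ihs]
  | inf t s iht ihs =>
    simp only [BTerm.eval]
    rw [inf_inf_distrib_right, iht, ihs, ← inf_inf_distrib_right]
  | compl t iht =>
    simp only [BTerm.eval]
    have key : ∀ x : B, xᶜ ⊓ m = (x ⊓ m)ᶜ ⊓ m := by
      intro x
      rw [compl_inf, inf_sup_right]
      simp
    rw [key, iht, ← key]

theorem constSubalg_lift {I B : Type} [BooleanAlgebra B] (c : I → B) (n : ℕ) {x : B}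
    (hx : x ∈ constSubalg c) : ∃ t : BTerm I n, ∀ b, t.eval c b = x := by
  obtain ⟨t, rfl⟩ := hx
  induction t with
  | var i => exact i.elim0
  | const j => exact ⟨.const j, fun _ => rfl⟩
  | bot => exact ⟨.bot, fun _ => rfl⟩
  | top => exact ⟨.top, fun _ => rfl⟩
  | sup t s iht ihs =>
    obtain ⟨t', ht⟩ := iht
    obtain ⟨s', hs⟩ := ihs
    exact ⟨.sup t' s', fun b => by simp only [BTerm.eval, ht, hs]⟩
  | inf t s iht ihs =>
    obtain ⟨t', ht⟩ := iht
    obtain ⟨s', hs⟩ := ihs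
    exact ⟨.inf t' s', fun b => by simp only [BTerm.eval, ht, hs]⟩
  | compl t iht =>
    obtain ⟨t', ht⟩ := iht
    exact ⟨.compl t', fun b => by simp only [BTerm.eval, ht]⟩

theorem constSubalg_bot {I B : Type} [BooleanAlgebra B] (c : I → B) :
    ⊥ ∈ constSubalg c := ⟨.bot, rfl⟩

theorem constSubalg_top {I B : Type} [BooleanAlgebra B] (c : I → B) :
    ⊤ ∈ constSubalg c := ⟨.top, rfl⟩

theorem constSubalg_sup {I B : Type} [BooleanAlgebra B] (c : I → B) {x y : B}
    (hx : x ∈ constSubalg c) (hy : y ∈ constSubalg c) : x ⊔ y ∈ constSubalg c := by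
  obtain ⟨t, rfl⟩ := hx
  obtain ⟨s, rfl⟩ := hy
  exact ⟨.sup t s, rfl⟩

theorem constSubalg_inf {I B : Type} [BooleanAlgebra B] (c : I → B) {x y : B}
    (hx : x ∈ constSubalg c) (hy : y ∈ constSubalg c) : x ⊓ y ∈ constSubalg c := by
  obtain ⟨t, rfl⟩ := hx
  obtain ⟨s, rfl⟩ := hy
  exact ⟨.inf t s, rfl⟩

theorem constSubalg_compl {I B : Type} [BooleanAlgebra B] (c : I → B) {x : B}
    (hx : x ∈ constSubalg c) : xᶜ ∈ constSubalg c := by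
  obtain ⟨t, rfl⟩ := hx
  exact ⟨.compl t, rfl⟩

theorem constSubalg_bihimp {I B : Type} [BooleanAlgebra B] (c : I → B) {x y : B}
    (hx : x ∈ constSubalg c) (hy : y ∈ constSubalg c) : bihimp x y ∈ constSubalg c := by
  rw [bihimp, himp_eq, himp_eq]
  exact constSubalg_inf c (constSubalg_sup c hx (constSubalg_compl c hy))
    (constSubalg_sup c hy (constSubalg_compl c hx))

theorem constSubalg_eval {I B : Type} [BooleanAlgebra B] (c : I → B) {n : ℕ}
    (b : Fin n → B) (hb : ∀ i, b i ∈ constSubalg c) (t : BTerm I n) :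
    t.eval c b ∈ constSubalg c := by
  induction t with
  | var i => exact hb i
  | const j => exact ⟨.const j, rfl⟩
  | bot => exact constSubalg_bot c
  | top => exact constSubalg_top c
  | sup t s iht ihs => exact constSubalg_sup c iht ihs
  | inf t s iht ihs => exact constSubalg_inf c iht ihs
  | compl t iht => exact constSubalg_compl c iht

theorem le_bihimp_iff_inf_eq {B : Type} [BooleanAlgebra B] (m u v : B) :
    m ≤ bihimp u v ↔ u ⊓ m = v ⊓ m := by
  rw [le_bihimp_iff]
  constructor
  · rintro ⟨h1, h2⟩
    rw [inf_comm] at h1 h2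
    apply le_antisymm
    · exact le_inf (by first | exact h1 | exact h2 | (rw [inf_comm]; first | exact h1 | exact h2)) inf_le_right
    · exact le_inf (by first | exact h1 | exact h2 | (rw [inf_comm]; first | exact h1 | exact h2)) inf_le_right
  · intro h
    have e1 : m ⊓ u ≤ v := by rw [inf_comm, h]; exact inf_le_left
    have e2 : m ⊓ v ≤ u := by rw [inf_comm, ← h]; exact inf_le_left
    simp only [inf_comm] at e1 e2 ⊢
    tauto

/-- The minterm of `b` with sign pattern `ε`, over the coordinates in `s`. -/
def minterm {B : Type} [BooleanAlgebra B] {n : ℕ} (ε : Fin n → Bool) (s : Finset (Fin n))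
    (b : Fin n → B) : B :=
  s.inf fun i => if ε i then b i else (b i)ᶜ

theorem minterm_cover {B : Type} [BooleanAlgebra B] {n : ℕ} (b : Fin n → B) (u w : B)
    (s : Finset (Fin n)) : (∀ ε, u ⊓ minterm ε s b ≤ w) → u ≤ w := by
  classical
  induction s using Finset.induction_on with
  | empty => intro h; simpa [minterm] using h (fun _ => true)
  | insert i s hi ih =>
    intro h
    apply ih
    intro ε
    have hup : ∀ v, minterm (Function.update ε i v) s b = minterm ε s b := by
      intro v
      apply Finset.inf_congr rfl
      intro j hj
      have : j ≠ i := fun e => hi (e ▸ hj)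
      simp [Function.update_of_ne this]
    have h1 := h (Function.update ε i true)
    have h2 := h (Function.update ε i false)
    have e1 : ∀ v, minterm (Function.update ε i v) (insert i s) b =
        (if v then b i else (b i)ᶜ) ⊓ minterm ε s b := by
      intro v
      rw [← hup v]
      simp [minterm, Finset.inf_insert]
    rw [e1] at h1 h2
    simp only [if_true] at h1
    simp only [Bool.false_eq_true, if_false] at h2
    calc u ⊓ minterm ε s b = u ⊓ ((b i ⊔ (b i)ᶜ) ⊓ minterm ε s b) := by simp
      _ = (u ⊓ (b i ⊓ minterm ε s b)) ⊔ (u ⊓ ((b i)ᶜ ⊓ minterm ε s b)) := by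
          rw [inf_sup_right, inf_sup_left]
      _ ≤ w := sup_le h1 h2

theorem minterm_term {I B : Type} [BooleanAlgebra B] (c : I → B) {n : ℕ} (ε : Fin n → Bool)
    (s : Finset (Fin n)) : ∃ t : BTerm I n, ∀ b, t.eval c b = minterm ε s b := by
  classical
  induction s using Finset.induction_on with
  | empty => exact ⟨.top, fun b => by simp [BTerm.eval, minterm]⟩
  | insert i s hi ih =>
    obtain ⟨t, ht⟩ := ih
    refine ⟨.inf (if ε i then .var i else .compl (.var i)) t, fun b => ?_⟩
    simp only [BTerm.eval, ht, minterm, Finset.inf_insert]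
    cases ε i <;> simp [BTerm.eval]

/-- The `0/1` point with sign pattern `ε`. -/
def vertex (B : Type) [BooleanAlgebra B] {n : ℕ} (ε : Fin n → Bool) : Fin n → B :=
  fun i => if ε i then ⊤ else ⊥

theorem eval_minterm {I B : Type} [BooleanAlgebra B] (c : I → B) {n : ℕ} (ε : Fin n → Bool)
    (b : Fin n → B) (t : BTerm I n) :
    t.eval c b ⊓ minterm ε Finset.univ b = t.eval c (vertex B ε) ⊓ minterm ε Finset.univ b := by
  apply BTerm.eval_inf_congr
  intro i
  have h : minterm ε Finset.univ b ≤ if ε i then b i else (b i)ᶜ :=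
    Finset.inf_le (f := fun i => if ε i then b i else (b i)ᶜ) (Finset.mem_univ i)
  unfold vertex
  cases hε : ε i
  · simp only [hε, Bool.false_eq_true, if_false] at h ⊢
    rw [bot_inf_eq, ← disjoint_iff, disjoint_comm]
    exact (le_compl_iff_disjoint_right).1 h
  · simp only [hε, if_true] at h ⊢
    rw [top_inf_eq]
    exact inf_eq_right.2 h

theorem vertex_mem {I B : Type} [BooleanAlgebra B] (c : I → B) {n : ℕ} (ε : Fin n → Bool)
    (i : Fin n) : vertex B ε i ∈ constSubalg c := by
  unfold vertex
  split
  · exact constSubalg_top c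
  · exact constSubalg_bot c

theorem eqn_iff {I B : Type} [BooleanAlgebra B] (c : I → B) {n : ℕ} (b : Fin n → B)
    (t s : BTerm I n) :
    t.eval c b = s.eval c b ↔ ∀ ε, minterm ε Finset.univ b ≤
      bihimp (t.eval c (vertex B ε)) (s.eval c (vertex B ε)) := by
  constructor
  · intro h ε
    rw [le_bihimp_iff_inf_eq, ← eval_minterm, ← eval_minterm, h]
  · intro h
    have h' : ∀ ε, t.eval c b ⊓ minterm ε Finset.univ b =
        s.eval c b ⊓ minterm ε Finset.univ b := by
      intro ε
      rw [eval_minterm, eval_minterm]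
      exact (le_bihimp_iff_inf_eq _ _ _).1 (h ε)
    apply le_antisymm
    · exact minterm_cover b _ _ Finset.univ fun ε => (h' ε).trans_le inf_le_left
    · exact minterm_cover b _ _ Finset.univ fun ε => (h' ε).symm.trans_le inf_le_left

theorem eqn_one_iff {I B : Type} [BooleanAlgebra B] (c : I → B) (b : B)
    (t s : BTerm I 1) (h0 : t.eval c (fun _ => ⊥) = s.eval c (fun _ => ⊥)) :
    t.eval c (fun _ => b) = s.eval c (fun _ => b) ↔
      b ≤ bihimp (t.eval c (fun _ => ⊤)) (s.eval c (fun _ => ⊤)) := by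
  have h1 : ∀ r : BTerm I 1, r.eval c (fun _ => b) ⊓ b = r.eval c (fun _ => ⊤) ⊓ b :=
    BTerm.eval_inf_congr c b _ _ (fun _ => by simp)
  have h2 : ∀ r : BTerm I 1, r.eval c (fun _ => b) ⊓ bᶜ = r.eval c (fun _ => ⊥) ⊓ bᶜ :=
    BTerm.eval_inf_congr c bᶜ _ _ (fun _ => by simp)
  rw [le_bihimp_iff_inf_eq]
  constructor
  · intro h
    rw [← h1, ← h1, h]
  · intro h
    have split : ∀ x : B, x = (x ⊓ b) ⊔ (x ⊓ bᶜ) := fun x => by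
      rw [← inf_sup_left]; simp
    rw [split (t.eval c _), split (s.eval c _), h1, h1, h2, h2, h, h0]

/-- Theorem 5: a Boolean C-algebra `B` is weakly equationally Noetherian iff the
subalgebra `C` of constants is complete in `B`, i.e. every subset of `C` has an
infimum in `B` and this infimum belongs to `C`. -/
theorem weaklyEqNoetherian_iff_constSubalg_complete {I B : Type} [BooleanAlgebra B]
    (c : I → B) :
    WeaklyEqNoetherian c ↔
      ∀ M ⊆ constSubalg c, ∃ b ∈ constSubalg c, IsGLB M b := by
  classical
  constructor
  · intro hW M hM
    obtain ⟨S', hfin, hS'⟩ := hW 1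
      {e | ∃ m ∈ M, (∀ b, e.1.eval c b = b 0 ⊓ m) ∧ e.2 = .var 0}
    have hsol : ∀ x : B, (fun _ => x) ∈ solSet c S' ↔ x ∈ lowerBounds M := by
      intro x
      rw [hS']
      constructor
      · intro h m hm
        obtain ⟨t, ht⟩ := constSubalg_lift c 1 (hM hm)
        have := h (.inf (.var 0) t, .var 0)
          ⟨m, hm, fun b => by simp [BTerm.eval, ht], rfl⟩
        simpa [BTerm.eval, ht] using this
      · rintro h ⟨e1, e2⟩ ⟨m, hm, he1, he2⟩
        simp only at he1 he2
        subst he2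
        simpa [he1, BTerm.eval] using h hm
    have hbot : (fun _ => (⊥ : B)) ∈ solSet c S' := (hsol ⊥).2 (fun m _ => bot_le)
    let k : BEqn I 1 → B := fun e =>
      bihimp (e.1.eval c (fun _ => ⊤)) (e.2.eval c (fun _ => ⊤))
    have hk : ∀ e, k e ∈ constSubalg c := fun e =>
      constSubalg_bihimp c (constSubalg_eval c _ (fun _ => constSubalg_top c) _)
        (constSubalg_eval c _ (fun _ => constSubalg_top c) _)
    have hmem : ∀ F : Finset (BEqn I 1), F.inf k ∈ constSubalg c := by
      intro F
      induction F using Finset.induction_on with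
      | empty => exact constSubalg_top c
      | insert e F _ ih =>
        rw [Finset.inf_insert]
        exact constSubalg_inf c (hk e) ih
    have hle : ∀ x : B, x ∈ lowerBounds M ↔ x ≤ hfin.toFinset.inf k := by
      intro x
      rw [← hsol, Finset.le_inf_iff]
      constructor
      · intro h e he
        have he' := hfin.mem_toFinset.1 he
        exact (eqn_one_iff c x e.1 e.2 (hbot e he')).1 (h e he')
      · intro h e he
        exact (eqn_one_iff c x e.1 e.2 (hbot e he)).2 (h e (hfin.mem_toFinset.2 he))
    exact ⟨_, hmem hfin.toFinset, (hle _).2 le_rfl, fun x hx => (hle x).1 hx⟩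
  · intro hC n S
    have hinf : ∀ ε : Fin n → Bool, ∃ g ∈ constSubalg c,
        IsGLB ((fun e : BEqn I n =>
          bihimp (e.1.eval c (vertex B ε)) (e.2.eval c (vertex B ε))) '' S) g := by
      intro ε
      apply hC
      rintro _ ⟨e, _, rfl⟩
      exact constSubalg_bihimp c (constSubalg_eval c _ (vertex_mem c ε) _)
        (constSubalg_eval c _ (vertex_mem c ε) _)
    choose g hg hglb using hinf
    choose G hG using fun ε => constSubalg_lift c n (hg ε)
    choose mt hmt using fun ε => minterm_term c (n := n) ε Finset.univ
    refine ⟨Set.range fun ε => (BTerm.inf (mt ε) (G ε), mt ε), Set.finite_range _, ?_⟩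
    ext b
    have h1 : b ∈ solSet c (Set.range fun ε => (BTerm.inf (mt ε) (G ε), mt ε)) ↔
        ∀ ε, minterm ε Finset.univ b ≤ g ε := by
      simp [solSet, BTerm.eval, hG, hmt]
    rw [h1]
    constructor
    · intro h e he
      rw [eqn_iff]
      intro ε
      exact (h ε).trans ((hglb ε).1 ⟨e, he, rfl⟩)
    · intro h ε
      apply (hglb ε).2
      rintro _ ⟨e, he, rfl⟩
      exact (eqn_iff c b e.1 e.2).1 (h e he) ε
end

section
/- A Boolean C-algebra B is q-compact if and only if there exist neither E₀-systems nor E₁-systems over B. -/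
/-- A system `S` over `B` is an `E_k`-system if `|V_B(S)| = k` while every finite
subsystem of `S` has an infinite solution set. -/
def IsEkSystem {I B : Type} [BooleanAlgebra B] (c : I → B) {n : ℕ}
    (S : Set (BEqn I n)) (k : ℕ) : Prop :=
  (solSet c S).Finite ∧ (solSet c S).ncard = k ∧
    ∀ Sp ⊆ S, Sp.Finite → (solSet c Sp).Infinite

/-- `B` is q-compact: whenever `V_B(S) ⊆ V_B(t = s)` for an equation `t = s`,
some finite subsystem `S' ⊆ S` already satisfies `V_B(S') ⊆ V_B(t = s)`. -/
def QCompact {I B : Type} [BooleanAlgebra B] (c : I → B) : Prop :=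
  ∀ (n : ℕ) (S : Set (BEqn I n)) (e : BEqn I n),
    solSet c S ⊆ solSet c {e} →
    ∃ Sp ⊆ S, Sp.Finite ∧ solSet c Sp ⊆ solSet c {e}

theorem solSet_anti {I B : Type} [BooleanAlgebra B] (c : I → B) {n : ℕ}
    {S T : Set (BEqn I n)} (h : S ⊆ T) : solSet c T ⊆ solSet c S :=
  fun _ hb e he => hb e (h he)

/-- Uniformization: finitely many monotone requirements on finite subsets of `S` can be met
simultaneously. -/
theorem unif {α β : Type} (S : Set β) (T : Set α) (hT : T.Finite)
    (Q : α → Set β → Prop) (hm : ∀ q s s', s ⊆ s' → Q q s → Q q s')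
    (h : ∀ q ∈ T, ∃ s ⊆ S, s.Finite ∧ Q q s) :
    ∃ s ⊆ S, s.Finite ∧ ∀ q ∈ T, Q q s := by
  choose! f hf using h
  refine ⟨⋃ q ∈ T, f q, ?_, hT.biUnion (fun q hq => (hf q hq).2.1), ?_⟩
  · exact Set.iUnion₂_subset fun q hq => (hf q hq).1
  · intro q hq
    exact hm q _ _ (Set.subset_biUnion_of_mem (u := f) hq) (hf q hq).2.2

theorem fin_cpt {I B : Type} [BooleanAlgebra B] (c : I → B) {n : ℕ}
    (S : Set (BEqn I n)) (P : Set (Fin n → B)) (hP : solSet c S ⊆ P)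
    (S0 : Set (BEqn I n)) (h0 : S0 ⊆ S) (hf0 : S0.Finite) (hf : (solSet c S0).Finite) :
    ∃ s ⊆ S, s.Finite ∧ solSet c s ⊆ P := by
  obtain ⟨s, hs, hsf, h⟩ := unif S (solSet c S0) hf (fun b s => b ∈ solSet c s → b ∈ P)
    (fun b s s' hss h hb => h (solSet_anti c hss hb))
    (by
      intro b _
      by_cases hb : b ∈ P
      · exact ⟨∅, by simp, by simp, fun _ => hb⟩
      · have : b ∉ solSet c S := fun h => hb (hP h)
        simp only [solSet, Set.mem_ofPred_eq, not_forall] at this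
        obtain ⟨e, he, hne⟩ := this
        exact ⟨{e}, by simpa using he, by simp, fun h => absurd (h e rfl) hne⟩)
  refine ⟨s ∪ S0, Set.union_subset hs h0, hsf.union hf0, fun b hb => ?_⟩
  exact h b (solSet_anti c Set.subset_union_right hb) (solSet_anti c Set.subset_union_left hb)

/-- Substitution. -/
def BTerm.bsubst {I : Type} {n m : ℕ} (f : Fin n → BTerm I m) : BTerm I n → BTerm I m
  | .var i => f i
  | .const j => .const j
  | .bot => .bot
  | .top => .top
  | .sup t s => .sup (t.bsubst f) (s.bsubst f)
  | .inf t s => .inf (t.bsubst f) (s.bsubst f)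
  | .compl t => .compl (t.bsubst f)

theorem BTerm.eval_bsubst {I B : Type} [BooleanAlgebra B] (c : I → B) {n m : ℕ}
    (f : Fin n → BTerm I m) (t : BTerm I n) (b : Fin m → B) :
    (t.bsubst f).eval c b = t.eval c (fun i => (f i).eval c b) := by
  induction t <;> simp_all [BTerm.bsubst, BTerm.eval]

theorem BTerm.eval_local {I B : Type} [BooleanAlgebra B] (c : I → B) {n : ℕ}
    (t : BTerm I n) (X Z : Fin n → B) (y : B) (h : ∀ i, X i ⊓ y = Z i ⊓ y) :
    t.eval c X ⊓ y = t.eval c Z ⊓ y := by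
  induction t with
  | var i => exact h i
  | const j => rfl
  | bot => rfl
  | top => rfl
  | sup t s h1 h2 => simp only [BTerm.eval, inf_sup_right, h1, h2]
  | inf t s h1 h2 => 
    simp only [BTerm.eval]
    rw [inf_inf_distrib_right, h1, h2, ← inf_inf_distrib_right]
  | compl t h1 =>
    simp only [BTerm.eval]
    have key : ∀ u : B, uᶜ ⊓ y = y \ (u ⊓ y) := by
      intro u
      rw [sdiff_inf_self_right, sdiff_eq, inf_comm]
    rw [key, key, h1]

theorem eq_of_pieces {B : Type} [BooleanAlgebra B] (u v y : B)
    (h1 : u ⊓ y = v ⊓ y) (h2 : u ⊓ yᶜ = v ⊓ yᶜ) : u = v := by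
  calc u = (u ⊓ y) ⊔ (u ⊓ yᶜ) := by rw [← inf_sup_left, sup_compl_eq_top, inf_top_eq]
    _ = (v ⊓ y) ⊔ (v ⊓ yᶜ) := by rw [h1, h2]
    _ = v := by rw [← inf_sup_left, sup_compl_eq_top, inf_top_eq]

/-- The 0/1 element of `B`. -/
def bval (B : Type) [BooleanAlgebra B] (a : Bool) : B := if a then ⊤ else ⊥

def bterm (I : Type) (m : ℕ) (a : Bool) : BTerm I m := if a then .top else .bot

theorem eval_bterm {I B : Type} [BooleanAlgebra B] (c : I → B) {m : ℕ} (a : Bool)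
    (b : Fin m → B) : (bterm I m a).eval c b = bval B a := by
  cases a <;> simp [bterm, bval, BTerm.eval]

theorem exists_cell {B : Type} [BooleanAlgebra B] {n : ℕ} (X : Fin n → B) (d : B) (hd : d ≠ ⊥) :
    ∃ a : Fin n → Bool, ∃ y ≤ d, y ≠ ⊥ ∧ ∀ i, X i ⊓ y = bval B (a i) ⊓ y := by
  have key : ∀ s : Finset (Fin n), ∃ y ≤ d, y ≠ ⊥ ∧ ∀ i ∈ s, ∃ a : Bool,
      X i ⊓ y = bval B a ⊓ y := by
    intro s
    induction s using Finset.induction_on with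
    | empty => exact ⟨d, le_rfl, hd, by simp⟩
    | insert j s _ ih =>
      obtain ⟨y, hy, hy0, h⟩ := ih
      have down : ∀ z ≤ y, ∀ i ∈ s, ∃ a : Bool, X i ⊓ z = bval B a ⊓ z := by
        intro z hz i hi
        obtain ⟨a, ha⟩ := h i hi
        refine ⟨a, ?_⟩
        rw [← inf_eq_right.2 hz, ← inf_assoc, ha, inf_assoc]
      by_cases hc : X j ⊓ y = ⊥
      · refine ⟨y, hy, hy0, fun i hi => ?_⟩
        rcases Finset.mem_insert.1 hi with rfl | hi
        · exact ⟨false, by simp [bval, hc]⟩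
        · exact h i hi
      · refine ⟨X j ⊓ y, inf_le_right.trans hy, hc, fun i hi => ?_⟩
        rcases Finset.mem_insert.1 hi with rfl | hi
        · exact ⟨true, by simp [bval]⟩
        · exact down _ inf_le_right i hi
  obtain ⟨y, hy, hy0, h⟩ := key Finset.univ
  choose a ha using fun i => h i (Finset.mem_univ i)
  exact ⟨a, y, hy, hy0, ha⟩

/-- The localized equation `l(a) ⊓ y = r(a) ⊓ y`. -/
def locEqn {I : Type} {n : ℕ} (a : Fin n → Bool) (e : BEqn I n) : BEqn I 1 :=
  (.inf (e.1.bsubst fun i => bterm I 1 (a i)) (.var 0),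
   .inf (e.2.bsubst fun i => bterm I 1 (a i)) (.var 0))

theorem locEqn_iff {I B : Type} [BooleanAlgebra B] (c : I → B) {n : ℕ} (a : Fin n → Bool)
    (e : BEqn I n) (b : Fin 1 → B) :
    ((locEqn a e).1.eval c b = (locEqn a e).2.eval c b) ↔
      e.1.eval c (fun i => bval B (a i)) ⊓ b 0 = e.2.eval c (fun i => bval B (a i)) ⊓ b 0 := by
  simp [locEqn, BTerm.eval, BTerm.eval_bsubst, eval_bterm]

theorem qCompact_of_no {I B : Type} [BooleanAlgebra B] (c : I → B)
    (H : ∀ (n : ℕ) (S : Set (BEqn I n)), ¬ IsEkSystem c S 0 ∧ ¬ IsEkSystem c S 1) :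
    QCompact c := by
  intro n S e hSe
  by_cases hne : (solSet c S).Nonempty
  swap
  · rw [Set.not_nonempty_iff_eq_empty] at hne
    have h0 := (H n S).1
    simp only [IsEkSystem, hne, Set.finite_empty, Set.ncard_empty, true_and, not_forall] at h0
    obtain ⟨S0, hS0, hf0, hinf⟩ := h0
    exact fin_cpt c S _ hSe S0 hS0 hf0 (Set.not_infinite.1 hinf)
  obtain ⟨p, hp⟩ := hne
  -- localized systems
  let e' : BEqn I n := (e.1, .compl e.2)
  let L : (Fin n → Bool) → Set (BEqn I 1) := fun a => locEqn a '' S ∪ {locEqn a e'}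
  have hL : ∀ a, solSet c (L a) = {fun _ => (⊥ : B)} := by
    intro a
    apply Set.Subset.antisymm
    · intro b hb
      have hz : b 0 = ⊥ := by
        set y := b 0 with hy
        let A : Fin n → B := fun i => bval B (a i)
        let X : Fin n → B := fun i => (p i ⊓ yᶜ) ⊔ (A i ⊓ y)
        have hXA : ∀ i, X i ⊓ y = A i ⊓ y := by
          intro i
          simp [X, inf_sup_right, inf_assoc]
        have hXp : ∀ i, X i ⊓ yᶜ = p i ⊓ yᶜ := by
          intro i
          simp [X, inf_sup_right, inf_assoc]
        have hX : X ∈ solSet c S := by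
          intro q hq
          apply eq_of_pieces _ _ y
          · rw [BTerm.eval_local c q.1 X A y hXA, BTerm.eval_local c q.2 X A y hXA]
            exact (locEqn_iff c a q b).1 (hb _ (Or.inl ⟨q, hq, rfl⟩))
          · rw [BTerm.eval_local c q.1 X p _ hXp, BTerm.eval_local c q.2 X p _ hXp, hp q hq]
        have h1 := hSe hX e rfl
        have h2 := (locEqn_iff c a e' b).1 (hb _ (Or.inr rfl))
        change e.1.eval c A ⊓ y = (e.2.eval c A)ᶜ ⊓ y at h2
        have h3 : e.1.eval c A ⊓ y = e.2.eval c A ⊓ y := by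
          rw [← BTerm.eval_local c e.1 X A y hXA, ← BTerm.eval_local c e.2 X A y hXA, h1]
        rw [h3] at h2
        calc y = (e.2.eval c A ⊓ y) ⊔ ((e.2.eval c A)ᶜ ⊓ y) := by
              rw [← inf_sup_right, sup_compl_eq_top, top_inf_eq]
          _ = (e.2.eval c A ⊓ y) ⊓ ((e.2.eval c A)ᶜ ⊓ y) := by rw [← h2]; simp
          _ = ⊥ := by rw [← inf_inf_distrib_right]; simp
      ext i
      rw [Subsingleton.elim i 0, hz]
    · rintro _ rfl
      rintro q (⟨q, _, rfl⟩ | rfl)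
      · rw [locEqn_iff]; simp
      · rw [locEqn_iff]; simp
  have hT : ∀ a, ∃ s ⊆ L a, s.Finite ∧ solSet c s ⊆ {fun _ => (⊥ : B)} := by
    intro a
    have h1 := (H 1 (L a)).2
    simp only [IsEkSystem, hL, Set.finite_singleton, Set.ncard_singleton, true_and,
      not_forall] at h1
    obtain ⟨S0, hS0, hf0, hinf⟩ := h1
    exact fin_cpt c (L a) _ (hL a).le S0 hS0 hf0 (Set.not_infinite.1 hinf)
  obtain ⟨s, hs, hsf, h⟩ := unif S (Set.univ : Set (Fin n → Bool)) Set.finite_univ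
    (fun a s => solSet c (locEqn a '' s ∪ {locEqn a e'}) ⊆ {fun _ => (⊥ : B)})
    (fun a s s' hss h => (solSet_anti c
      (Set.union_subset_union_left _ (Set.image_mono hss))).trans h)
    (by
      intro a _
      obtain ⟨T, hTL, hTf, hT0⟩ := hT a
      obtain ⟨s, hs, hsf, h⟩ := unif S T hTf
        (fun q s => q ∈ locEqn a '' s ∪ {locEqn a e'})
        (fun q s s' hss h => Set.union_subset_union_left _ (Set.image_mono hss) h)
        (by
          intro q hq
          rcases hTL hq with ⟨r, hr, rfl⟩ | hq
          · exact ⟨{r}, by simpa using hr, by simp, Or.inl ⟨r, rfl, rfl⟩⟩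
          · exact ⟨∅, by simp, by simp, Or.inr hq⟩)
      exact ⟨s, hs, hsf, (solSet_anti c h).trans hT0⟩)
  refine ⟨s, hs, hsf, fun X hX => ?_⟩
  suffices hgoal : e.1.eval c X = e.2.eval c X by
    rintro _ rfl
    exact hgoal
  by_contra hne
  obtain ⟨a, y, hyd, hy0, hy⟩ := exists_cell X (symmDiff (e.1.eval c X) (e.2.eval c X))
    (by simpa using hne)
  apply hy0
  have hmem : (fun _ => y) ∈ solSet c (locEqn a '' s ∪ {locEqn a e'}) := by
    rintro q (⟨q, hq, rfl⟩ | rfl)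
    · rw [locEqn_iff, ← BTerm.eval_local c q.1 X _ y hy, ← BTerm.eval_local c q.2 X _ y hy,
        hX q hq]
    · rw [locEqn_iff, ← BTerm.eval_local c e'.1 X _ y hy, ← BTerm.eval_local c e'.2 X _ y hy]
      change e.1.eval c X ⊓ y = (e.2.eval c X)ᶜ ⊓ y
      generalize e.1.eval c X = u at *
      generalize e.2.eval c X = v at *
      have hk : u ⊓ symmDiff u v = vᶜ ⊓ symmDiff u v := by
        rw [symmDiff_eq]
        simp only [inf_sup_left]
        have e1 : u ⊓ (v ⊓ uᶜ) = ⊥ := by rw [inf_left_comm]; simp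
        have e2 : vᶜ ⊓ (v ⊓ uᶜ) = ⊥ := by rw [← inf_assoc]; simp
        have e3 : vᶜ ⊓ (u ⊓ vᶜ) = u ⊓ vᶜ := by rw [inf_left_comm]; simp
        rw [e1, e2, e3]; simp
      rw [← inf_eq_right.2 hyd, ← inf_assoc, hk, inf_assoc]
  exact congrFun (h a trivial hmem) 0

theorem no_E0 {I B : Type} [BooleanAlgebra B] (c : I → B) (hq : QCompact c)
    (n : ℕ) (S : Set (BEqn I n)) : ¬ IsEkSystem c S 0 := by
  rintro ⟨hf, hc, hi⟩
  rw [Set.ncard_eq_zero hf] at hc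
  obtain ⟨s, hs, hsf, h⟩ := hq n S (.bot, .top) (by rw [hc]; simp)
  have hinf := hi s hs hsf
  obtain ⟨b, hb⟩ := hinf.nonempty
  have hbt : (⊥ : B) = ⊤ := h hb _ rfl
  have : Subsingleton B := subsingleton_of_bot_eq_top hbt
  exact hinf (Set.toFinite _)

def renEqn {I : Type} {n m : ℕ} (f : Fin n → Fin m) (e : BEqn I n) : BEqn I m :=
  (e.1.bsubst fun i => .var (f i), e.2.bsubst fun i => .var (f i))

theorem renEqn_iff {I B : Type} [BooleanAlgebra B] (c : I → B) {n m : ℕ} (f : Fin n → Fin m)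
    (e : BEqn I n) (b : Fin m → B) :
    ((renEqn f e).1.eval c b = (renEqn f e).2.eval c b) ↔
      e.1.eval c (fun i => b (f i)) = e.2.eval c (fun i => b (f i)) := by
  simp [renEqn, BTerm.eval, BTerm.eval_bsubst]

theorem no_E1 {I B : Type} [BooleanAlgebra B] (c : I → B) (hq : QCompact c)
    (n : ℕ) (S : Set (BEqn I n)) : ¬ IsEkSystem c S 1 := by
  rintro ⟨_, hc, hi⟩
  obtain ⟨p, hp⟩ := Set.ncard_eq_one.1 hc
  let D : Set (BEqn I n) → Set (BEqn I (n + n)) := fun S =>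
    renEqn (Fin.castAdd n) '' S ∪ renEqn (Fin.natAdd n) '' S
  have hD : ∀ s s' : Set (BEqn I n), s ⊆ s' → D s ⊆ D s' := fun s s' h =>
    Set.union_subset_union (Set.image_mono h) (Set.image_mono h)
  have hsol : ∀ s b, b ∈ solSet c (D s) ↔ (fun i => b (Fin.castAdd n i)) ∈ solSet c s ∧
      (fun i => b (Fin.natAdd n i)) ∈ solSet c s := by
    intro s b
    constructor
    · intro h
      exact ⟨fun q hq => (renEqn_iff c _ q b).1 (h _ (Or.inl ⟨q, hq, rfl⟩)),
        fun q hq => (renEqn_iff c _ q b).1 (h _ (Or.inr ⟨q, hq, rfl⟩))⟩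
    · rintro ⟨h1, h2⟩ _ (⟨q, hq, rfl⟩ | ⟨q, hq, rfl⟩)
      · exact (renEqn_iff c _ q b).2 (h1 q hq)
      · exact (renEqn_iff c _ q b).2 (h2 q hq)
  obtain ⟨s, hs, hsf, h⟩ := unif S (Set.univ : Set (Fin n)) Set.finite_univ
    (fun i s => ∀ b ∈ solSet c (D s), b (Fin.castAdd n i) = b (Fin.natAdd n i))
    (fun i s s' hss h b hb => h b (solSet_anti c (hD _ _ hss) hb))
    (by
      intro i _
      obtain ⟨T, hTL, hTf, hT⟩ := hq (n + n) (D S)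
        (.var (Fin.castAdd n i), .var (Fin.natAdd n i)) (by
          intro b hb
          rintro _ rfl
          obtain ⟨h1, h2⟩ := (hsol S b).1 hb
          rw [hp] at h1 h2
          exact congrFun (h1.trans h2.symm) i)
      obtain ⟨s, hs, hsf, h⟩ := unif S T hTf (fun q s => q ∈ D s)
        (fun q s s' hss h => hD _ _ hss h)
        (by
          intro q hq
          rcases hTL hq with ⟨r, hr, rfl⟩ | ⟨r, hr, rfl⟩
          · exact ⟨{r}, by simpa using hr, by simp, Or.inl ⟨r, rfl, rfl⟩⟩
          · exact ⟨{r}, by simpa using hr, by simp, Or.inr ⟨r, rfl, rfl⟩⟩)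
      exact ⟨s, hs, hsf, fun b hb => hT (solSet_anti c h hb) _ rfl⟩)
  apply hi s hs hsf
  apply Set.Subsingleton.finite
  intro x hx z hz
  ext i
  have := h i trivial (Fin.append x z) ((hsol s _).2
    (by simp only [Fin.append_left, Fin.append_right]; exact ⟨hx, hz⟩))
  simpa only [Fin.append_left, Fin.append_right] using this

/-- Theorem 6: a Boolean C-algebra `B` is q-compact iff there exist neither
`E₀`- nor `E₁`-systems over `B`. -/
theorem qCompact_iff_no_E0_E1 {I B : Type} [BooleanAlgebra B] (c : I → B) :
    QCompact c ↔
      ∀ (n : ℕ) (S : Set (BEqn I n)), ¬ IsEkSystem c S 0 ∧ ¬ IsEkSystem c S 1 := by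
  exact ⟨fun hq n S => ⟨no_E0 c hq n S, no_E1 c hq n S⟩, qCompact_of_no c⟩
end

section
/- Let B₁, B₂ be Boolean C-algebras whose constant symbols generate the same subalgebra C. Then for every finite system of equations S one has Rad_{B₁}(S) = Rad_{B₂}(S). -/
/-- The radical `Rad_B(S)`: the set of all equations that hold on `V_B(S)`. -/
def radical {I B : Type} [BooleanAlgebra B] (c : I → B) {n : ℕ}
    (S : Set (BEqn I n)) : Set (BEqn I n) :=
  {e | solSet c S ⊆ solSet c {e}}

/-- Two Boolean C-algebras are geometrically equivalent if every system of
equations has the same radical over both of them. -/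
def GeomEquiv {I B₁ B₂ : Type} [BooleanAlgebra B₁] [BooleanAlgebra B₂]
    (c₁ : I → B₁) (c₂ : I → B₂) : Prop :=
  ∀ (n : ℕ) (S : Set (BEqn I n)), radical c₁ S = radical c₂ S

/-- The constant symbols generate the same subalgebra `C` in both algebras:
two closed terms have equal values in `B₁` iff they have equal values in `B₂`
(so the subalgebras generated by the constants are canonically isomorphic). -/
def SameConstAlg {I B₁ B₂ : Type} [BooleanAlgebra B₁] [BooleanAlgebra B₂]
    (c₁ : I → B₁) (c₂ : I → B₂) : Prop :=
  ∀ t s : BTerm I 0,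
    t.eval c₁ (fun i => i.elim0) = s.eval c₁ (fun i => i.elim0) ↔
    t.eval c₂ (fun i => i.elim0) = s.eval c₂ (fun i => i.elim0)

namespace RadAux

def iteB {B : Type} [BooleanAlgebra B] (u x y : B) : B := (u ⊓ x) ⊔ (uᶜ ⊓ y)

theorem inf_iteB {B : Type} [BooleanAlgebra B] (u x y : B) : u ⊓ iteB u x y = u ⊓ x := by
  simp [iteB, inf_sup_left, ← inf_assoc]

theorem compl_inf_iteB {B : Type} [BooleanAlgebra B] (u x y : B) :
    uᶜ ⊓ iteB u x y = uᶜ ⊓ y := by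
  simp [iteB, inf_sup_left, ← inf_assoc]

theorem inf_compl_aux {B : Type} [BooleanAlgebra B] (u x : B) :
    u ⊓ xᶜ = u ⊓ (u ⊓ x)ᶜ := by
  simp [compl_inf, inf_sup_left]

theorem eval_local {I B : Type} [BooleanAlgebra B] (c : I → B) {n : ℕ} (t : BTerm I n)
    (u : B) (x y : Fin n → B) (h : ∀ i, u ⊓ x i = u ⊓ y i) :
    u ⊓ t.eval c x = u ⊓ t.eval c y := by
  induction t with
  | var i => exact h i
  | const j => rfl
  | bot => rfl
  | top => rfl
  | sup t s iht ihs => simp only [BTerm.eval, inf_sup_left, iht, ihs]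
  | inf t s iht ihs => simp only [BTerm.eval, inf_inf_distrib_left u, iht, ihs]
  | compl t iht => 
    simp only [BTerm.eval]
    rw [inf_compl_aux, iht, ← inf_compl_aux]

theorem eval_iteB {I B : Type} [BooleanAlgebra B] (c : I → B) {n : ℕ} (t : BTerm I n)
    (u : B) (x y : Fin n → B) :
    t.eval c (fun i => iteB u (x i) (y i)) = iteB u (t.eval c x) (t.eval c y) := by
  have h1 := eval_local c t u (fun i => iteB u (x i) (y i)) x (fun i => inf_iteB u _ _)
  have h2 := eval_local c t uᶜ (fun i => iteB u (x i) (y i)) y (fun i => compl_inf_iteB u _ _)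
  unfold iteB at *
  rw [← h1, ← h2, ← inf_sup_right, sup_compl_eq_top, top_inf_eq]

theorem le_iteB {B : Type} [BooleanAlgebra B] {p x y : B} (u : B) (hx : p ≤ x) (hy : p ≤ y) :
    p ≤ iteB u x y := by
  calc p = (u ⊓ p) ⊔ (uᶜ ⊓ p) := by rw [← inf_sup_right, sup_compl_eq_top, top_inf_eq]
    _ ≤ _ := sup_le_sup (inf_le_inf_left _ hx) (inf_le_inf_left _ hy)

def bv (B : Type) [BooleanAlgebra B] (a : Bool) : B := if a then ⊤ else ⊥

/-- A term is bounded below on all of `B` by any lower bound on Boolean vectors. -/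
theorem le_eval {I B : Type} [BooleanAlgebra B] (c : I → B) {n : ℕ} (t : BTerm I n)
    (p : B) (h : ∀ a : Fin n → Bool, p ≤ t.eval c (fun i => bv B (a i)))
    (b : Fin n → B) : p ≤ t.eval c b := by
  have key : ∀ s : Finset (Fin n), ∀ b : Fin n → B,
      (∀ i, i ∉ s → ∃ a : Bool, b i = bv B a) → p ≤ t.eval c b := by
    intro s
    induction s using Finset.induction_on with
    | empty =>
      intro b hb
      choose a ha using fun i => hb i (by simp)
      have : b = fun i => bv B (a i) := funext ha
      rw [this]; exact h a
    | insert j s hj ih =>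
      intro b hb
      have hbit : b = fun i => iteB (b j) (Function.update b j ⊤ i) (Function.update b j ⊥ i) := by
        funext i
        by_cases hi : i = j
        · subst hi; simp [iteB]
        · simp [hi, iteB, ← inf_sup_right]
      rw [hbit, eval_iteB]
      apply le_iteB
      · apply ih
        intro i hi
        by_cases hij : i = j
        · subst hij; exact ⟨true, by simp [bv]⟩
        · simpa [hij] using hb i (by simp [hij, hi])
      · apply ih
        intro i hi
        by_cases hij : i = j
        · subst hij; exact ⟨false, by simp [bv]⟩
        · simpa [hij] using hb i (by simp [hij, hi])
  exact key Finset.univ b (by simp)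

def subst {I : Type} {n m : ℕ} (k : Fin n → BTerm I m) : BTerm I n → BTerm I m
  | .var i => k i
  | .const j => .const j
  | .bot => .bot
  | .top => .top
  | .sup t s => .sup (subst k t) (subst k s)
  | .inf t s => .inf (subst k t) (subst k s)
  | .compl t => .compl (subst k t)

theorem eval_subst {I B : Type} [BooleanAlgebra B] (c : I → B) {n m : ℕ}
    (k : Fin n → BTerm I m) (t : BTerm I n) (b : Fin m → B) :
    (subst k t).eval c b = t.eval c (fun i => (k i).eval c b) := by
  induction t <;> simp_all [subst, BTerm.eval]

def iteT {I : Type} {n : ℕ} (u x y : BTerm I n) : BTerm I n :=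
  .sup (.inf u x) (.inf (.compl u) y)

/-- Every term attains its minimum at a tuple of closed terms. -/
theorem exists_min {I : Type} {n : ℕ} (t : BTerm I n) :
    ∃ k : Fin n → BTerm I 0, ∀ (B : Type) [BooleanAlgebra B] (c : I → B) (b : Fin n → B),
      (subst k t).eval c (fun i => i.elim0) ≤ t.eval c b := by
  have key : ∀ s : Finset (Fin n → Bool), ∃ k : Fin n → BTerm I 0,
      ∀ (B : Type) [BooleanAlgebra B] (c : I → B), ∀ a ∈ s,
      (subst k t).eval c (fun i => i.elim0) ≤ t.eval c (fun i => bv B (a i)) := by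
    intro s
    induction s using Finset.induction_on with
    | empty => exact ⟨fun _ => .bot, by simp⟩
    | insert a s ha ih =>
      obtain ⟨k, hk⟩ := ih
      refine ⟨fun i => iteT (subst k t) (if a i then .top else .bot) (k i), ?_⟩
      intro B _ c
      have h : (subst (fun i => iteT (subst k t) (if a i then .top else .bot) (k i)) t).eval c
          (fun i => i.elim0) = (subst k t).eval c (fun i => i.elim0) ⊓
            t.eval c (fun i => bv B (a i)) := by
        rw [eval_subst]
        have : (fun i => (iteT (subst k t) (if a i then .top else .bot) (k i)).eval c
            (fun i => i.elim0)) = fun i => iteB ((subst k t).eval c (fun i => i.elim0))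
              (bv B (a i)) ((k i).eval c (fun i => i.elim0)) := by
          funext i
          cases h : a i <;> simp [iteT, BTerm.eval, iteB, bv]
        rw [this, eval_iteB, ← eval_subst, iteB]
        simp
      intro a' ha'
      rw [h]
      rcases Finset.mem_insert.1 ha' with rfl | h'
      · exact inf_le_right
      · exact inf_le_left.trans (hk B c a' h')
  obtain ⟨k, hk⟩ := key Finset.univ
  exact ⟨k, fun B _ c b => le_eval c t _ (fun a => hk B c a (Finset.mem_univ _)) b⟩

def diffT {I : Type} {n : ℕ} (t s : BTerm I n) : BTerm I n :=
  .sup (.inf t (.compl s)) (.inf s (.compl t))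

theorem eval_diffT {I B : Type} [BooleanAlgebra B] (c : I → B) {n : ℕ} (t s : BTerm I n)
    (b : Fin n → B) : (diffT t s).eval c b = ⊥ ↔ t.eval c b = s.eval c b := by
  simp only [diffT, BTerm.eval, sup_eq_bot_iff, ← sdiff_eq, sdiff_eq_bot_iff]
  exact ⟨fun h => le_antisymm h.1 h.2, fun h => ⟨h.le, h.ge⟩⟩

theorem exists_single {I : Type} {n : ℕ} (S : Set (BEqn I n)) (hfin : S.Finite) :
    ∃ t : BTerm I n, ∀ (B : Type) [BooleanAlgebra B] (c : I → B) (b : Fin n → B),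
      b ∈ solSet c S ↔ t.eval c b = ⊥ := by
  induction S, hfin using Set.Finite.induction_on with
  | empty => exact ⟨.bot, by simp [solSet, BTerm.eval]⟩
  | @insert e S _ _ ih =>
    obtain ⟨t, ht⟩ := ih
    refine ⟨.sup (diffT e.1 e.2) t, fun B _ c b => ?_⟩
    have := ht B c b
    simp only [solSet, Set.mem_setOf_eq] at this
    simp only [BTerm.eval, sup_eq_bot_iff, eval_diffT, ← this, solSet, Set.mem_setOf_eq,
      Set.forall_mem_insert]

theorem transfer {I B₁ B₂ : Type} [BooleanAlgebra B₁] [BooleanAlgebra B₂]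
    (c₁ : I → B₁) (c₂ : I → B₂) (hC : SameConstAlg c₁ c₂) {n : ℕ} (t s : BTerm I n)
    (h : ∀ b, t.eval c₂ b = ⊥ → s.eval c₂ b = ⊥) (b : Fin n → B₁) (hb : t.eval c₁ b = ⊥) :
    s.eval c₁ b = ⊥ := by
  obtain ⟨k, hk⟩ := exists_min t
  obtain ⟨m, hm⟩ := exists_min (.sup (.compl s) t)
  have k1 : (subst k t).eval c₁ (fun i => i.elim0) = ⊥ := le_bot_iff.1 (hb ▸ hk B₁ c₁ b)
  have k2 : (subst k t).eval c₂ (fun i => i.elim0) = ⊥ := (hC (subst k t) .bot).1 k1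
  rw [eval_subst] at k2
  set K : Fin n → B₂ := fun i => (k i).eval c₂ (fun i => i.elim0)
  have m2 : (subst m (.sup (.compl s) t)).eval c₂ (fun i => i.elim0) = ⊤ := by
    rw [eval_subst]
    set M : Fin n → B₂ := fun i => (m i).eval c₂ (fun i => i.elim0)
    have hv := h (fun i => iteB (t.eval c₂ M) (K i) (M i))
      (by rw [eval_iteB, k2]; simp [iteB])
    rw [eval_iteB] at hv
    have h2 := (sup_eq_bot_iff.1 hv).2
    simp only [BTerm.eval]
    rw [← compl_inj_iff]
    simpa [inf_comm] using h2
  have m1 : (subst m (.sup (.compl s) t)).eval c₁ (fun i => i.elim0) = ⊤ :=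
    (hC _ .top).2 m2
  have := hm B₁ c₁ b
  rw [m1] at this
  simpa [BTerm.eval, hb] using this

theorem radical_le {I B₁ B₂ : Type} [BooleanAlgebra B₁] [BooleanAlgebra B₂]
    (c₁ : I → B₁) (c₂ : I → B₂) (hC : SameConstAlg c₁ c₂)
    {n : ℕ} (S : Set (BEqn I n)) (hfin : S.Finite) :
    radical c₂ S ⊆ radical c₁ S := by
  intro e he b hb
  obtain ⟨t, ht⟩ := exists_single S hfin
  obtain ⟨s, hs⟩ := exists_single {e} (Set.finite_singleton e)
  exact (hs B₁ c₁ b).2 (transfer c₁ c₂ hC t s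
    (fun b hb => (hs B₂ c₂ b).1 (he ((ht B₂ c₂ b).2 hb))) b ((ht B₁ c₁ b).1 hb))

end RadAux

/-- Theorem 9(1): for any finite system `S`, the radicals of `S` over two Boolean
C-algebras with the same subalgebra of constants coincide. -/
theorem radical_eq_of_finite {I B₁ B₂ : Type} [BooleanAlgebra B₁] [BooleanAlgebra B₂]
    (c₁ : I → B₁) (c₂ : I → B₂) (hC : SameConstAlg c₁ c₂)
    {n : ℕ} (S : Set (BEqn I n)) (hfin : S.Finite) :
    radical c₁ S = radical c₂ S := by
  exact Set.Subset.antisymm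
    (RadAux.radical_le c₂ c₁ (fun t s => (hC t s).symm) S hfin)
    (RadAux.radical_le c₁ c₂ hC S hfin)
end

section
/- If two Boolean C-algebras B₁, B₂ (whose constant symbols generate the same subalgebra C) are both q-compact, then they are geometrically equivalent. -/
def BTerm.subst {I : Type} {n : ℕ} (a : Fin n → BTerm I 0) : BTerm I n → BTerm I 0
  | .var i => a i
  | .const j => .const j
  | .bot => .bot
  | .top => .top
  | .sup t s => .sup (t.subst a) (s.subst a)
  | .inf t s => .inf (t.subst a) (s.subst a)
  | .compl t => .compl (t.subst a)

/-- value of a closed term -/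
def BTerm.cval {I B : Type} [BooleanAlgebra B] (c : I → B) (t : BTerm I 0) : B :=
  t.eval c (fun i => i.elim0)

theorem BTerm.cval_subst {I B : Type} [BooleanAlgebra B] (c : I → B) {n : ℕ}
    (a : Fin n → BTerm I 0) (t : BTerm I n) :
    (t.subst a).cval c = t.eval c (fun i => (a i).cval c) := by
  unfold BTerm.cval
  induction t <;> simp_all [BTerm.subst, BTerm.eval]

theorem inf_compl_aux {B : Type} [BooleanAlgebra B] (p x : B) : p ⊓ xᶜ = p ⊓ (p ⊓ x)ᶜ := by
  rw [compl_inf, inf_sup_left]; simp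

theorem BTerm.eval_congr {I B : Type} [BooleanAlgebra B] (c : I → B) {n : ℕ}
    (p : B) (b b' : Fin n → B) (h : ∀ i, p ⊓ b i = p ⊓ b' i) (t : BTerm I n) :
    p ⊓ t.eval c b = p ⊓ t.eval c b' := by
  induction t with
  | var i => exact h i
  | const j => rfl
  | bot => rfl
  | top => rfl
  | sup t s iht ihs => simp only [BTerm.eval, inf_sup_left, iht, ihs]
  | inf t s iht ihs =>
    simp only [BTerm.eval]
    rw [inf_inf_distrib_left, iht, ihs, ← inf_inf_distrib_left]
  | compl t iht =>
    simp only [BTerm.eval]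
    rw [inf_compl_aux, iht, ← inf_compl_aux]

/-- `a` where `d` holds, `a'` elsewhere -/
def BTerm.mix {I : Type} {n : ℕ} (d : BTerm I 0) (a a' : Fin n → BTerm I 0) :
    Fin n → BTerm I 0 :=
  fun i => .sup (.inf d (a i)) (.inf (.compl d) (a' i))

theorem BTerm.mix_left {I B : Type} [BooleanAlgebra B] (c : I → B) {n : ℕ}
    (d : BTerm I 0) (a a' : Fin n → BTerm I 0) (t : BTerm I n) :
    d.cval c ⊓ (t.subst (mix d a a')).cval c = d.cval c ⊓ (t.subst a).cval c := by
  rw [cval_subst, cval_subst]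
  apply eval_congr
  intro i
  simp [BTerm.mix, BTerm.cval, BTerm.eval, inf_sup_left, ← inf_assoc]

theorem BTerm.mix_right {I B : Type} [BooleanAlgebra B] (c : I → B) {n : ℕ}
    (d : BTerm I 0) (a a' : Fin n → BTerm I 0) (t : BTerm I n) :
    (d.cval c)ᶜ ⊓ (t.subst (mix d a a')).cval c = (d.cval c)ᶜ ⊓ (t.subst a').cval c := by
  rw [cval_subst, cval_subst]
  apply eval_congr
  intro i
  simp [BTerm.mix, BTerm.cval, BTerm.eval, inf_sup_left, ← inf_assoc]

def BTerm.ofBool {I : Type} {n : ℕ} (e : Fin n → Bool) : Fin n → BTerm I 0 :=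
  fun i => if e i then .top else .bot

theorem exists_local {I B : Type} [BooleanAlgebra B] (c : I → B) {n : ℕ}
    (b : Fin n → B) (x : B) (hx : x ≠ ⊥) :
    ∃ (e : Fin n → Bool) (p : B), p ≠ ⊥ ∧ p ≤ x ∧ ∀ t : BTerm I n,
      p ⊓ t.eval c b = p ⊓ (t.subst (BTerm.ofBool e)).cval c := by
  have key : ∀ F : Finset (Fin n), ∃ (p : B), p ≠ ⊥ ∧ p ≤ x ∧ ∀ i ∈ F,
      p ≤ b i ∨ p ≤ (b i)ᶜ := by
    intro F
    induction F using Finset.induction_on with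
    | empty => exact ⟨x, hx, le_rfl, by simp⟩
    | insert i F _ ih =>
      obtain ⟨p, hp, hpx, h⟩ := ih
      by_cases hb : p ⊓ b i = ⊥
      · refine ⟨p, hp, hpx, ?_⟩
        intro j hj
        rcases Finset.mem_insert.1 hj with rfl | hj
        · right
          exact le_compl_iff_disjoint_right.2 (disjoint_iff.2 hb)
        · exact h j hj
      · refine ⟨p ⊓ b i, hb, inf_le_left.trans hpx, ?_⟩
        intro j hj
        rcases Finset.mem_insert.1 hj with rfl | hj
        · left; exact inf_le_right
        · exact (h j hj).imp inf_le_left.trans inf_le_left.trans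
  obtain ⟨p, hp, hpx, h⟩ := key Finset.univ
  classical
  refine ⟨fun i => decide (p ≤ b i), p, hp, hpx, fun t => ?_⟩
  rw [BTerm.cval_subst]
  apply BTerm.eval_congr
  intro i
  by_cases hi : p ≤ b i
  · simp [BTerm.ofBool, hi, BTerm.cval, BTerm.eval]
  · have := (h i (Finset.mem_univ i)).resolve_left hi
    simp [BTerm.ofBool, hi, BTerm.cval, BTerm.eval]
    exact disjoint_iff.1 (le_compl_iff_disjoint_right.1 this)

theorem exists_min {I B : Type} [BooleanAlgebra B] (c : I → B) {n : ℕ} (t : BTerm I n)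
    (F : Finset (Fin n → Bool)) :
    ∃ a : Fin n → BTerm I 0, ∀ e ∈ F,
      (t.subst a).cval c ≤ (t.subst (BTerm.ofBool e)).cval c := by
  classical
  induction F using Finset.induction_on with
  | empty => exact ⟨fun _ => .bot, by simp⟩
  | insert e F _ ih =>
    obtain ⟨a, ha⟩ := ih
    let d : BTerm I 0 := t.subst (BTerm.ofBool e)
    have hl := BTerm.mix_left c d a (BTerm.ofBool e) t
    have hr := BTerm.mix_right c d a (BTerm.ofBool e) t
    have hr' : (d.cval c)ᶜ ⊓ (t.subst (BTerm.mix d a (BTerm.ofBool e))).cval c = ⊥ := by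
      rw [hr]; exact compl_inf_self _
    have h1 : (t.subst (BTerm.mix d a (BTerm.ofBool e))).cval c ≤ d.cval c := by
      have := disjoint_iff.2 hr'
      exact disjoint_compl_left_iff.1 this
    rw [inf_eq_right.2 h1] at hl
    refine ⟨BTerm.mix d a (BTerm.ofBool e), fun e' he' => ?_⟩
    rcases Finset.mem_insert.1 he' with rfl | he'
    · exact h1
    · rw [hl]; exact inf_le_right.trans (ha e' he')

theorem exists_closed {I B : Type} [BooleanAlgebra B] (c : I → B) {n : ℕ} (t s : BTerm I n)
    (b : Fin n → B) (ht : t.eval c b = ⊥) (hs : s.eval c b ≠ ⊥) :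
    ∃ a : Fin n → BTerm I 0, (t.subst a).cval c = ⊥ ∧ (s.subst a).cval c ≠ ⊥ := by
  obtain ⟨a, ha⟩ := exists_min c t Finset.univ
  have hta : (t.subst a).cval c = ⊥ := by
    by_contra hne
    obtain ⟨e, p, hp, hpx, h⟩ := exists_local c b _ hne
    have h1 := h t
    rw [ht, inf_bot_eq, inf_eq_left.2 (hpx.trans (ha e (Finset.mem_univ e)))] at h1
    exact hp h1.symm
  obtain ⟨e, p, hp, hpx, h⟩ := exists_local c b _ hs
  let d : BTerm I 0 := t.subst (BTerm.ofBool e)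
  refine ⟨BTerm.mix d a (BTerm.ofBool e), ?_, ?_⟩
  · have hl := BTerm.mix_left c d a (BTerm.ofBool e) t
    have hr := BTerm.mix_right c d a (BTerm.ofBool e) t
    rw [hta, inf_bot_eq] at hl
    have hr' : (d.cval c)ᶜ ⊓ (t.subst (BTerm.mix d a (BTerm.ofBool e))).cval c = ⊥ := by
      rw [hr]; exact compl_inf_self _
    have h1 := disjoint_compl_left_iff.1 (disjoint_iff.2 hr')
    rwa [inf_eq_right.2 h1] at hl
  · intro h0
    have hr := BTerm.mix_right c d a (BTerm.ofBool e) s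
    rw [h0, inf_bot_eq] at hr
    have h1 := h t
    rw [ht, inf_bot_eq] at h1
    have h2 : p ≤ (d.cval c)ᶜ := le_compl_iff_disjoint_right.2 (disjoint_iff.2 h1.symm)
    have h3 := h s
    rw [inf_eq_left.2 hpx] at h3
    have h4 : p ≤ (s.subst (BTerm.ofBool e)).cval c := inf_eq_left.1 h3.symm
    exact hp (le_bot_iff.1 (hr ▸ le_inf h2 h4))

/-- symmetric difference of the two sides of an equation -/
def BEqn.diff {I : Type} {n : ℕ} (e : BEqn I n) : BTerm I n :=
  .sup (.inf e.1 (.compl e.2)) (.inf e.2 (.compl e.1))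

theorem BEqn.diff_eq {I B : Type} [BooleanAlgebra B] (c : I → B) {n : ℕ} (e : BEqn I n)
    (b : Fin n → B) : (BEqn.diff e).eval c b = ⊥ ↔ e.1.eval c b = e.2.eval c b := by
  rw [← symmDiff_eq_bot (a := e.1.eval c b), symmDiff, sdiff_eq, sdiff_eq]
  rfl

theorem exists_single {I B : Type} [BooleanAlgebra B] (c : I → B) {n : ℕ}
    (S : Set (BEqn I n)) (hS : S.Finite) :
    ∃ t : BTerm I n, ∀ b, t.eval c b = ⊥ ↔ b ∈ solSet c S := by
  induction S, hS using Set.Finite.induction_on with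
  | empty => exact ⟨.bot, fun b => by simp [BTerm.eval, solSet]⟩
  | @insert e S _ _ ih =>
    obtain ⟨t, ht⟩ := ih
    refine ⟨.sup (BEqn.diff e) t, fun b => ?_⟩
    have h1 := BEqn.diff_eq c e b
    have h2 := ht b
    simp only [solSet, Set.mem_ofPred_eq] at h2
    simp only [BTerm.eval, sup_eq_bot_iff, solSet, Set.mem_ofPred_eq, Set.forall_mem_insert, h1, h2]

theorem radical_sub {I B₁ B₂ : Type}
    [BooleanAlgebra B₁] [BooleanAlgebra B₂]
    (c₁ : I → B₁) (c₂ : I → B₂) (hC : SameConstAlg c₁ c₂)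
    (h₁ : QCompact c₁) (n : ℕ) (S : Set (BEqn I n)) : radical c₁ S ⊆ radical c₂ S := by
  intro e he b hb
  obtain ⟨Sp, hSp, hfin, hsub⟩ := h₁ n S e he
  obtain ⟨t, ht⟩ := exists_single c₂ Sp hfin
  have tr : ∀ (a : Fin n → BTerm I 0) (f : BEqn I n),
      f.1.eval c₁ (fun i => (a i).cval c₁) = f.2.eval c₁ (fun i => (a i).cval c₁) ↔
      f.1.eval c₂ (fun i => (a i).cval c₂) = f.2.eval c₂ (fun i => (a i).cval c₂) := by
    intro a f
    simp only [← BTerm.cval_subst]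
    exact hC _ _
  have goal : e.1.eval c₂ b = e.2.eval c₂ b := by
    by_contra hne
    rw [← BEqn.diff_eq] at hne
    obtain ⟨a, ha1, ha2⟩ := exists_closed c₂ t (BEqn.diff e) b
      ((ht b).2 fun f hf => hb f (hSp hf)) hne
    rw [BTerm.cval_subst] at ha1 ha2
    rw [ht] at ha1
    rw [Ne, BEqn.diff_eq, ← tr] at ha2
    exact ha2 (hsub (fun f hf => (tr a f).2 (ha1 f hf)) e rfl)
  intro f hf
  rw [Set.mem_singleton_iff.1 hf]
  exact goal

/-- Theorem 9(4): two q-compact Boolean C-algebras with the same subalgebra of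
constants are geometrically equivalent. -/
theorem geomEquiv_of_qCompact {I B₁ B₂ : Type}
    [BooleanAlgebra B₁] [BooleanAlgebra B₂]
    (c₁ : I → B₁) (c₂ : I → B₂) (hC : SameConstAlg c₁ c₂)
    (h₁ : QCompact c₁) (h₂ : QCompact c₂) :
    GeomEquiv c₁ c₂ := by
  intro n S
  apply Set.Subset.antisymm
  · exact radical_sub c₁ c₂ hC h₁ n S
  · exact radical_sub c₂ c₁ (fun t s => (hC t s).symm) h₂ n S
end

section
/- Let B be a Boolean C-algebra and let t(X), s(X) be L-terms in the variables X = {x₁,…,xₙ}. Then there exist constants c_α ∈ C indexed by the tuples α = (a₁,…,aₙ) ∈ {0,1}ⁿ such that for every point b = (b₁,…,bₙ) ∈ Bⁿ one has t(b) = s(b) if and only if b₁^{a₁} ∧ b₂^{a₂} ∧ … ∧ bₙ^{aₙ} ≤ c_α for every α ∈ {0,1}ⁿ, where b^1 denotes b and b^0 denotes the complement ¬b. -/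
/-- Substitute truth values for the variables. -/
def BTerm.substBool {I : Type} {n : ℕ} (α : Fin n → Bool) : BTerm I n → BTerm I 0
  | .var i => if α i then .top else .bot
  | .const j => .const j
  | .bot => .bot
  | .top => .top
  | .sup t s => .sup (t.substBool α) (s.substBool α)
  | .inf t s => .inf (t.substBool α) (s.substBool α)
  | .compl t => .compl (t.substBool α)

theorem inf_compl_congr_aux {B : Type} [BooleanAlgebra B] {m x y : B}
    (h : m ⊓ x = m ⊓ y) : m ⊓ xᶜ = m ⊓ yᶜ := by
  have h1 : m ⊓ xᶜ = m \ (m ⊓ x) := by rw [sdiff_inf_self_left, sdiff_eq]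
  have h2 : m ⊓ yᶜ = m \ (m ⊓ y) := by rw [sdiff_inf_self_left, sdiff_eq]
  rw [h1, h2, h]

theorem BTerm.inf_eval_substBool {I B : Type} [BooleanAlgebra B] (c : I → B) {n : ℕ}
    (α : Fin n → Bool) (b : Fin n → B) (m : B)
    (hm : ∀ i, m ≤ if α i then b i else (b i)ᶜ) (z : Fin 0 → B) (t : BTerm I n) :
    m ⊓ t.eval c b = m ⊓ (t.substBool α).eval c z := by
  induction t with
  | var i =>
    have h := hm i
    cases hα : α i
    · simp only [hα, Bool.false_eq_true, if_false] at h
      simp only [BTerm.substBool, hα, Bool.false_eq_true, if_false, BTerm.eval, inf_bot_eq]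
      exact (le_compl_iff_disjoint_right.1 h).eq_bot
    · simp only [hα, if_true] at h
      simpa [BTerm.substBool, hα, BTerm.eval] using h
  | const j => rfl
  | bot => rfl
  | top => rfl
  | sup t s iht ihs => simp only [BTerm.substBool, BTerm.eval, inf_sup_left, iht, ihs]
  | inf t s iht ihs =>
    simp only [BTerm.substBool, BTerm.eval]
    rw [inf_inf_distrib_left, iht, ihs, ← inf_inf_distrib_left]
  | compl t iht => exact inf_compl_congr_aux iht

theorem le_of_minterms_aux {B : Type} [BooleanAlgebra B] {n : ℕ} (b : Fin n → B) (x y : B)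
    (S : Finset (Fin n))
    (h : ∀ α : Fin n → Bool, (S.inf fun i => if α i then b i else (b i)ᶜ) ⊓ x ≤ y) :
    x ≤ y := by
  induction S using Finset.induction_on with
  | empty => simpa using h (fun _ => true)
  | insert i S hi ih =>
    apply ih
    intro α
    have key : ∀ v : Bool, (S.inf fun j => if Function.update α i v j then b j else (b j)ᶜ)
        = S.inf fun j => if α j then b j else (b j)ᶜ := by
      intro v
      apply Finset.inf_congr rfl
      intro j hj
      have : j ≠ i := fun e => hi (e ▸ hj)
      simp [Function.update_of_ne this]
    have h1 := h (Function.update α i true)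
    have h2 := h (Function.update α i false)
    rw [Finset.inf_insert, key, inf_assoc] at h1 h2
    simp only [Function.update_self, if_true, Bool.false_eq_true, if_false] at h1 h2
    have := sup_le h1 h2
    rwa [← inf_sup_right, sup_compl_eq_top, top_inf_eq] at this

theorem inf_eq_iff_aux {B : Type} [BooleanAlgebra B] (m x y : B) :
    m ⊓ x = m ⊓ y ↔ m ≤ (x ⊓ y) ⊔ (xᶜ ⊓ yᶜ) := by
  constructor
  · intro h
    have h' := inf_compl_congr_aux h
    have e1 : m ⊓ (x ⊓ y) = m ⊓ x := by
      rw [inf_inf_distrib_left, ← h, inf_idem]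
    have e2 : m ⊓ (xᶜ ⊓ yᶜ) = m ⊓ xᶜ := by
      rw [inf_inf_distrib_left, ← h', inf_idem]
    rw [← inf_eq_left, inf_sup_left, e1, e2, ← inf_sup_left, sup_compl_eq_top, inf_top_eq]
  · intro h
    rw [← inf_eq_left.2 h, inf_assoc, inf_assoc]
    congr 1
    have e1 : xᶜ ⊓ yᶜ ⊓ x = ⊥ := by
      rw [inf_right_comm, compl_inf_eq_bot, bot_inf_eq]
    have e2 : xᶜ ⊓ yᶜ ⊓ y = ⊥ := by
      rw [inf_assoc, compl_inf_eq_bot, inf_bot_eq]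
    rw [inf_sup_right, inf_sup_right, e1, e2, inf_right_comm, inf_idem, inf_assoc x y y, inf_idem]

/-- Reduction of an equation to normal form: for any terms `t, s` in the
variables `x₁, …, xₙ` there are constants `c_α ∈ C` indexed by
`α ∈ {0,1}ⁿ` such that a point `b ∈ Bⁿ` satisfies `t(b) = s(b)` iff
`b₁^{a₁} ⊓ … ⊓ bₙ^{aₙ} ≤ c_α` for every `α = (a₁,…,aₙ)`, where `b^1 = b` and
`b^0 = bᶜ`. -/
theorem equation_normal_form {I B : Type} [BooleanAlgebra B] (c : I → B)
    {n : ℕ} (t s : BTerm I n) :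
    ∃ cc : (Fin n → Bool) → B, (∀ α, cc α ∈ constSubalg c) ∧
      ∀ b : Fin n → B,
        (t.eval c b = s.eval c b ↔
          ∀ α : Fin n → Bool,
            (Finset.univ.inf fun i => if α i then b i else (b i)ᶜ) ≤ cc α) := by
  refine ⟨fun α => BTerm.eval c (.sup (.inf (t.substBool α) (s.substBool α))
    (.inf (.compl (t.substBool α)) (.compl (s.substBool α)))) (fun i => i.elim0),
    fun α => ⟨_, rfl⟩, fun b => ?_⟩
  simp only [BTerm.eval, ← inf_eq_iff_aux]
  have key : ∀ (α : Fin n → Bool) (r : BTerm I n), _ := fun α r =>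
    BTerm.inf_eval_substBool c α b (Finset.univ.inf fun i => if α i then b i else (b i)ᶜ)
      (fun i => Finset.inf_le (Finset.mem_univ i)) (fun i => i.elim0) r
  simp only [← key]
  constructor
  · intro h α
    rw [h]
  · intro h
    apply le_antisymm
    · exact le_of_minterms_aux b _ _ Finset.univ fun α => (h α).le.trans inf_le_right
    · exact le_of_minterms_aux b _ _ Finset.univ fun α => (h α).ge.trans inf_le_right
end

section
/- Let B be a Boolean algebra, let m ≥ 1, and for each j ∈ {1,…,m} let C_j ⊆ B be a set of elements and V_j = {x ∈ B : x ≤ c for every c ∈ C_j}. If every V_j is infinite, then there exist nonzero elements q_j ∈ V_j (j = 1,…,m) that are pairwise disjoint, i.e. q_j ∧ q_k = 0 for all j ≠ k. -/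
/-- An infinite lower set stays infinite below `p` or below `q` when `p ⊔ q = ⊤`,
phrased with the elements disjoint from two disjoint elements. -/
theorem aux_split {B : Type} [BooleanAlgebra B] {I : Set B} (hl : IsLowerSet I)
    (hi : I.Infinite) {p q : B} (hpq : Disjoint p q)
    (hp : {x ∈ I | Disjoint x p}.Finite) : {x ∈ I | Disjoint x q}.Infinite := by
  intro hq
  refine hi (Set.Finite.subset (hp.image2 (fun a b => a ⊔ b) hq) ?_)
  intro x hx
  refine ⟨x \ p, ⟨hl sdiff_le hx, disjoint_sdiff_self_left⟩, x ⊓ p,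
    ⟨hl inf_le_left hx, hpq.mono_left inf_le_right⟩, ?_⟩
  exact (sup_comm (x \ p) (x ⊓ p)).trans (sup_inf_sdiff x p)

theorem aux_lower {B : Type} [BooleanAlgebra B] {I : Set B} (hl : IsLowerSet I) (q : B) :
    IsLowerSet {x ∈ I | Disjoint x q} :=
  fun _ _ hab ha => ⟨hl hab ha.1, ha.2.mono_left hab⟩

theorem aux_one {B : Type} [BooleanAlgebra B] {I : Set B} (hl : IsLowerSet I)
    (hi : I.Infinite) : ∃ q ∈ I, q ≠ ⊥ ∧ {x ∈ I | Disjoint x q}.Infinite := by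
  obtain ⟨x, hx, hx0⟩ := (hi.sdiff (Set.finite_singleton ⊥)).nonempty
  by_cases h : {y ∈ I | Disjoint y x}.Finite
  · have h2 := aux_split hl hi disjoint_compl_right h
    obtain ⟨y, ⟨hyI, hy⟩, hy0⟩ :=
      (h2.sdiff (Set.toFinite {⊥, x})).nonempty
    simp only [Set.mem_insert_iff, Set.mem_singleton_iff, not_or] at hy0
    have hyx : y ≤ x := disjoint_compl_right_iff.1 hy
    by_cases h3 : {z ∈ I | Disjoint z y}.Finite
    · refine ⟨x \ y, hl sdiff_le hx, ?_, aux_split hl hi disjoint_sdiff_self_right h3⟩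
      intro h4
      exact hy0.2 (le_antisymm hyx (sdiff_eq_bot_iff.1 h4))
    · exact ⟨y, hyI, hy0.1, h3⟩
  · exact ⟨x, hx, hx0, h⟩

theorem aux_cons {B : Type} [BooleanAlgebra B] {n : ℕ} {q : B} {f : Fin n → B}
    (h : ∀ i, Disjoint (f i) q) (hf : ∀ i j, i ≠ j → Disjoint (f i) (f j)) :
    ∀ i j, i ≠ j → Disjoint ((Fin.cons q f : Fin (n+1) → B) i)
      ((Fin.cons q f : Fin (n+1) → B) j) := by
  intro i j hij
  induction i using Fin.cases with
  | zero =>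
    induction j using Fin.cases with
    | zero => exact absurd rfl hij
    | succ j => simpa using (h j).symm
  | succ i =>
    induction j using Fin.cases with
    | zero => simpa using h i
    | succ j => simpa using hf i j (fun e => hij (e ▸ rfl))

theorem aux_many {B : Type} [BooleanAlgebra B] (n : ℕ) : ∀ {I : Set B}, IsLowerSet I →
    I.Infinite → ∃ f : Fin n → B, (∀ i, f i ∈ I ∧ f i ≠ ⊥) ∧
      ∀ i j, i ≠ j → Disjoint (f i) (f j) := by
  induction n with
  | zero => intro I _ _; exact ⟨fun _ => ⊥, fun i => i.elim0, fun i => i.elim0⟩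
  | succ n ih =>
    intro I hl hi
    obtain ⟨q, hq, hq0, hqi⟩ := aux_one hl hi
    obtain ⟨f, hf, hd⟩ := ih (aux_lower hl q) hqi
    refine ⟨Fin.cons q f, ?_, aux_cons (fun i => (hf i).1.2) hd⟩
    intro i
    induction i using Fin.cases with
    | zero => exact ⟨hq, hq0⟩
    | succ i => exact ⟨(hf i).1.1, (hf i).2⟩

theorem aux_main {B : Type} [BooleanAlgebra B] (n : ℕ) : ∀ I : Fin n → Set B,
    (∀ i, IsLowerSet (I i)) → (∀ i, (I i).Infinite) →
    ∃ f : Fin n → B, (∀ i, f i ∈ I i ∧ f i ≠ ⊥) ∧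
      ∀ i j, i ≠ j → Disjoint (f i) (f j) := by
  induction n with
  | zero => intro I _ _; exact ⟨fun _ => ⊥, fun i => i.elim0, fun i => i.elim0⟩
  | succ n ih =>
    intro I hl hi
    obtain ⟨a, ha, had⟩ := aux_many (n+1) (hl 0) (hi 0)
    have key : ∃ k, ∀ j : Fin n, {x ∈ I j.succ | Disjoint x (a k)}.Infinite := by
      by_contra hcon
      simp only [not_exists, not_forall, Set.not_infinite] at hcon
      choose g hg using hcon
      obtain ⟨k, l, hkl, hgkl⟩ := Fintype.exists_ne_map_eq_of_card_lt g (by simp)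
      have h1 := hg l
      rw [← hgkl] at h1
      exact aux_split (hl _) (hi _) (had k l hkl) (hg k) h1
    obtain ⟨k, hk⟩ := key
    obtain ⟨f, hf, hd⟩ := ih _ (fun j => aux_lower (hl j.succ) (a k)) hk
    refine ⟨Fin.cons (a k) f, ?_, aux_cons (fun i => (hf i).1.2) hd⟩
    intro i
    induction i using Fin.cases with
    | zero => exact ha k
    | succ i => exact ⟨(hf i).1.1, (hf i).2⟩

/-- If, for each `j ∈ {1,…,m}` (`m ≥ 1`), the set `V_j` of common lower bounds of
a set `C_j ⊆ B` is infinite, then one can choose nonzero elements `q_j ∈ V_j`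
that are pairwise disjoint. -/
theorem exists_pairwise_disjoint_nonzero_lower_bounds {B : Type} [BooleanAlgebra B]
    (m : ℕ) (hm : 1 ≤ m) (C : Fin m → Set B)
    (hinf : ∀ j, {x : B | ∀ c ∈ C j, x ≤ c}.Infinite) :
    ∃ q : Fin m → B, (∀ j, (∀ c ∈ C j, q j ≤ c) ∧ q j ≠ ⊥) ∧
      ∀ j k, j ≠ k → q j ⊓ q k = ⊥ := by
  obtain ⟨f, hf, hd⟩ := aux_main m (fun j => {x : B | ∀ c ∈ C j, x ≤ c})
    (fun j a b hab ha c hc => hab.trans (ha c hc)) hinf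
  exact ⟨f, hf, fun j k h => (hd j k h).eq_bot⟩
end
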